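/- (Weak form of the Nullstellensatz.) Let A denote the algebra G_{m,n} or T_{m,n}, and let J be a prime ideal of A. Then Z(J) ≠ ∅ if and only if A/J has PI-degree n. -/

import Mathlib

set_option linter.unusedSectionVars false

noncomputable section

universe u

-- Throughout, `k` is an algebraically closed base field of characteristic zero.
variable (k : Type) [Field k] [IsAlgClosed k] [CharZero k]

/-- Index type for the `m·n²` commuting variables `x_{ij}^{(h)}`. -/
abbrev MIdx (n m : ℕ) := Fin m × Fin n × Fin n

/-- The commutative polynomial ring `k[x_{ij}^{(h)}]`. -/
abbrev PolyRing (n m : ℕ) := MvPolynomial (MIdx n m) k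

/-- Matrices over the polynomial ring `k[x_{ij}^{(h)}]`. -/
abbrev MatPoly (n m : ℕ) := Matrix (Fin n) (Fin n) (PolyRing k n m)

/-- The space `(M_n)^m` of `m`-tuples of `n×n` matrices over `k`. -/
abbrev MTuple (n m : ℕ) := Fin m → Matrix (Fin n) (Fin n) k

/-- The `h`-th generic `n×n` matrix `X_h = (x_{ij}^{(h)})`. -/
def genericMatrix (n m : ℕ) (h : Fin m) : MatPoly k n m :=
  Matrix.of fun i j => MvPolynomial.X (h, i, j)

/-- `G_{m,n}`, the algebra of `m` generic `n×n` matrices: the `k`-subalgebra of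
`M_n(k[x_{ij}^{(h)}])` generated by the generic matrices. -/
def GMN (n m : ℕ) : Subalgebra k (MatPoly k n m) :=
  Algebra.adjoin k (Set.range (genericMatrix k n m))

/-- Evaluation of the commuting variables at a point `a ∈ (M_n)^m`. -/
def polyEval {n m : ℕ} (a : MTuple k n m) : PolyRing k n m →ₐ[k] k :=
  MvPolynomial.aeval fun x : MIdx n m => a x.1 x.2.1 x.2.2

/-- Evaluation of matrix-valued polynomials at a point `a ∈ (M_n)^m`; under this
map an element of `G_{m,n}` (or `T_{m,n}`) becomes a `PGL_n`-equivariant polynomial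
map `(M_n)^m → M_n`. -/
def evalMat {n m : ℕ} (a : MTuple k n m) :
    MatPoly k n m →ₐ[k] Matrix (Fin n) (Fin n) k :=
  (polyEval k a).mapMatrix

/-- The scalar matrix `tr(p)·1 ∈ M_n(k[x_{ij}^{(h)}])`. -/
def traceScalar {n m : ℕ} (p : MatPoly k n m) : MatPoly k n m :=
  algebraMap (PolyRing k n m) (MatPoly k n m) (Matrix.trace p)

/-- `T_{m,n}`, the trace ring of `G_{m,n}`: the `k`-algebra generated inside
`M_n(k[x_{ij}^{(h)}])` by `G_{m,n}` together with the traces of its elements. -/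
def TMN (n m : ℕ) : Subalgebra k (MatPoly k n m) :=
  Algebra.adjoin k ((GMN k n m : Set (MatPoly k n m)) ∪
    (traceScalar k '' (GMN k n m : Set (MatPoly k n m))))

lemma GMN_le_TMN (n m : ℕ) : GMN k n m ≤ TMN k n m :=
  fun _ hx => Algebra.subset_adjoin (Or.inl hx)

/-- The inclusion `G_{m,n} → T_{m,n}`. -/
def inclGT (n m : ℕ) : ↥(GMN k n m) →+* ↥(TMN k n m) :=
  (Subalgebra.inclusion (GMN_le_TMN k n m) : ↥(GMN k n m) →ₐ[k] ↥(TMN k n m)).toRingHom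

/-- `U_{m,n}`: the set of `m`-tuples of `n×n` matrices generating `M_n` as a
`k`-algebra. -/
def genTuples (n m : ℕ) : Set (MTuple k n m) :=
  {a | Algebra.adjoin k (Set.range a) = ⊤}

/-- Simultaneous conjugation of an `m`-tuple by `g ∈ GL_n(k)`; since scalar
matrices act trivially, this is the `PGL_n`-action on `(M_n)^m`. -/
def conjAct {n m : ℕ} (g : GL (Fin n) k) (a : MTuple k n m) : MTuple k n m :=
  fun i =>
    (g : Matrix (Fin n) (Fin n) k) * a i * ((g⁻¹ : GL (Fin n) k) : Matrix (Fin n) (Fin n) k)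

/-- Zariski closed subsets of `(M_n)^m`. -/
def IsZClosed {n m : ℕ} (C : Set (MTuple k n m)) : Prop :=
  ∃ S : Set (PolyRing k n m), C = {a | ∀ p ∈ S, polyEval k a p = 0}

/-- `X` is an `n`-variety: a closed `PGL_n`-invariant subvariety of `U_{m,n}`,
i.e. `X = X̄ ∩ U_{m,n}` where `X̄` is the Zariski closure of `X` in `(M_n)^m`. -/
def IsNVariety {n m : ℕ} (X : Set (MTuple k n m)) : Prop :=
  X ⊆ genTuples k n m ∧
  (∀ g : GL (Fin n) k, ∀ a ∈ X, conjAct k g a ∈ X) ∧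
  ∃ C, IsZClosed k C ∧ X = C ∩ genTuples k n m

/-- Irreducibility of a subset of `(M_n)^m` with respect to the Zariski topology. -/
def IsIrredSubset {n m : ℕ} (X : Set (MTuple k n m)) : Prop :=
  X.Nonempty ∧ ∀ C₁ C₂ : Set (MTuple k n m), IsZClosed k C₁ → IsZClosed k C₂ →
    X ⊆ C₁ ∪ C₂ → X ⊆ C₁ ∨ X ⊆ C₂

/-- The zero locus in `U_{m,n}` of a set of matrix-valued polynomials. -/
def zeroLocus {n m : ℕ} (S : Set (MatPoly k n m)) : Set (MTuple k n m) :=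
  {a | a ∈ genTuples k n m ∧ ∀ p ∈ S, evalMat k a p = 0}

/-- The zero locus in `U_{m,n}` of a two-sided ideal of a subalgebra `A` of
`M_n(k[x_{ij}^{(h)}])` (such as `G_{m,n}` or `T_{m,n}`). -/
def zeroLocusI {n m : ℕ} {A : Subalgebra k (MatPoly k n m)} (J : TwoSidedIdeal ↥A) :
    Set (MTuple k n m) :=
  {a | a ∈ genTuples k n m ∧ ∀ p : ↥A, p ∈ J → evalMat k a (p : MatPoly k n m) = 0}

/-- The vanishing (two-sided) ideal of a subset `X ⊆ (M_n)^m` in a subalgebra `A`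
of `M_n(k[x_{ij}^{(h)}])`; for `A = G_{m,n}` this is `I(X)`, for `A = T_{m,n}`
this is `I_T(X)`. -/
def vanishIdeal {n m : ℕ} (A : Subalgebra k (MatPoly k n m)) (X : Set (MTuple k n m)) :
    TwoSidedIdeal ↥A :=
  TwoSidedIdeal.mk' {p : ↥A | ∀ a ∈ X, evalMat k a (p : MatPoly k n m) = 0}
    (fun a _ => by simp)
    (fun {p q} hp hq a ha => by
      have : ((p + q : ↥A) : MatPoly k n m) = (p : MatPoly k n m) + q := rfl
      simp [this, map_add, hp a ha, hq a ha])
    (fun {p} hp a ha => by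
      have : ((-p : ↥A) : MatPoly k n m) = -(p : MatPoly k n m) := rfl
      simp [this, map_neg, hp a ha])
    (fun {p q} hq a ha => by
      have : ((p * q : ↥A) : MatPoly k n m) = (p : MatPoly k n m) * q := rfl
      simp [this, map_mul, hq a ha])
    (fun {p q} hp a ha => by
      have : ((p * q : ↥A) : MatPoly k n m) = (p : MatPoly k n m) * q := rfl
      simp [this, map_mul, hp a ha])

/-- Restriction: a matrix-valued polynomial gives an `M_n`-valued function on `X`. -/
def restrictTo {n m : ℕ} (X : Set (MTuple k n m)) :
    MatPoly k n m →ₐ[k] (X → Matrix (Fin n) (Fin n) k) :=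
  Pi.algHom k _ fun a => evalMat k a.val

/-- The PI-coordinate ring `k_n[X] = G_{m,n}/I(X)`, realized concretely as the
algebra of all restrictions to `X` of elements of `G_{m,n}` (i.e. of
`PGL_n`-equivariant morphisms `X → M_n` coming from `G_{m,n}`). -/
def coordRing {n m : ℕ} (X : Set (MTuple k n m)) :
    Subalgebra k (X → Matrix (Fin n) (Fin n) k) :=
  (GMN k n m).map (restrictTo k X)

/-- The ring `T_{m,n}/I_T(X)`, realized concretely as the algebra of all
restrictions to `X` of elements of `T_{m,n}`. -/
def coordTraceRing {n m : ℕ} (X : Set (MTuple k n m)) :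
    Subalgebra k (X → Matrix (Fin n) (Fin n) k) :=
  (TMN k n m).map (restrictTo k X)

/-- A ring is prime if it is nonzero and `a·R·b = 0` implies `a = 0` or `b = 0`. -/
def IsPrimeRing (R : Type u) [Ring R] : Prop :=
  Nontrivial R ∧ ∀ a b : R, (∀ x : R, a * x * b = 0) → a = 0 ∨ b = 0

/-- `Q` is a central simple algebra of degree `n`: a simple ring whose center is a
field, and which has dimension `n²` over its center. -/
def IsCSAOfDegree (n : ℕ) (Q : Type u) [Ring Q] : Prop :=
  IsSimpleRing Q ∧
  ∃ (K : Type u) (_ : Field K) (_ : Algebra K Q),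
    (algebraMap K Q).range = Subring.center Q ∧ Module.finrank K Q = n ^ 2

/-- A (prime PI-) ring `R` has PI-degree `n` if its total ring of fractions — the
central localization of `R` at its nonzero central elements — is a central simple
algebra of degree `n`. -/
def HasPIDegree (n : ℕ) (R : Type u) [Ring R] : Prop :=
  ∃ (Q : Type u) (_ : Ring Q) (f : R →+* Q),
    Function.Injective f ∧
    (∀ c ∈ Subring.center R, c ≠ 0 → IsUnit (f c)) ∧
    (∀ q : Q, ∃ r : R, ∃ c ∈ Subring.center R, c ≠ 0 ∧ q * f c = f r) ∧
    IsCSAOfDegree n Q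

/-- The quotient of a ring by a two-sided ideal. -/
abbrev idealQuot {R : Type u} [Ring R] (J : TwoSidedIdeal R) : Type u := J.ringCon.Quotient

/-- `Spec_n(R)`: the set of prime (two-sided) ideals `J` of `R` such that `R/J` is a
prime ring of PI-degree `n`. -/
def SpecN (n : ℕ) (R : Type u) [Ring R] : Set (TwoSidedIdeal R) :=
  {J | IsPrimeRing (idealQuot J) ∧ HasPIDegree n (idealQuot J)}

/-- A regular map of `n`-varieties `X → Y ⊆ U_{l,n}`: a map of the form
`a ↦ (f₁(a), …, f_l(a))` with each `f_i ∈ k_n[X]`, i.e. each component is the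
restriction to `X` of an element of `G_{m,n}`. -/
def IsRegMapOn {n m l : ℕ} (X : Set (MTuple k n m)) (Y : Set (MTuple k n l))
    (φ : MTuple k n m → MTuple k n l) : Prop :=
  (∀ a ∈ X, φ a ∈ Y) ∧
  ∃ F : Fin l → MatPoly k n m, (∀ i, F i ∈ GMN k n m) ∧
    ∀ a ∈ X, ∀ i, φ a i = evalMat k a (F i)

/-- `X` and `Y` are isomorphic `n`-varieties: there are mutually inverse regular
maps of `n`-varieties between them. -/
def NIsomorphic {n m l : ℕ} (X : Set (MTuple k n m)) (Y : Set (MTuple k n l)) : Prop :=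
  ∃ (φ : MTuple k n m → MTuple k n l) (ψ : MTuple k n l → MTuple k n m),
    IsRegMapOn k X Y φ ∧ IsRegMapOn k Y X ψ ∧
    (∀ a ∈ X, ψ (φ a) = a) ∧ (∀ b ∈ Y, φ (ψ b) = b)
open scoped TensorProduct

lemma simple_baseChange (K Q L : Type) [Field K] [Field L] [Ring Q] [Algebra K Q] [Algebra K L]
    [IsSimpleRing Q] (hc : ∀ q ∈ Subring.center Q, ∃ t : K, algebraMap K Q t = q) :
    IsSimpleRing (L ⊗[K] Q) := by
  classical
  haveI : Nontrivial (L ⊗[K] Q) := by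
    have := (Algebra.TensorProduct.includeRight_injective (R := K) (A := L) (B := Q)
      (algebraMap K L).injective)
    exact this.nontrivial
  apply IsSimpleRing.of_eq_bot_or_eq_top
  intro I
  by_cases hI : I = ⊥
  · exact Or.inl hI
  right
  let b := Module.Basis.ofVectorSpace K L
  let e := TensorProduct.equivFinsuppOfBasisLeft (N := Q) b
  have eL : ∀ (a : Q) (y : L ⊗[K] Q) i, e ((1 ⊗ₜ a) * y) i = a * e y i := by
    intro a y i
    induction y using TensorProduct.induction_on with
    | zero => simp
    | add x y hx hy => simp [mul_add, hx, hy]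
    | tmul x y => simp [e, TensorProduct.equivFinsuppOfBasisLeft_apply_tmul_apply]
  have eR : ∀ (a : Q) (y : L ⊗[K] Q) i, e (y * (1 ⊗ₜ a)) i = e y i * a := by
    intro a y i
    induction y using TensorProduct.induction_on with
    | zero => simp
    | add x y hx hy => simp [add_mul, hx, hy]
    | tmul x y => simp [e, TensorProduct.equivFinsuppOfBasisLeft_apply_tmul_apply]
  have hex : ∃ N, ∃ y ∈ I, y ≠ 0 ∧ (e y).support.card = N := by
    by_contra hne
    push Not at hne
    apply hI
    ext x
    constructor
    · intro hx
      by_contra hx0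
      exact hne _ x hx (fun h => hx0 (by rw [h]; exact TwoSidedIdeal.zero_mem _)) rfl
    · intro hx
      have : x = 0 := hx
      rw [this]; exact TwoSidedIdeal.zero_mem _
  obtain ⟨y, hyI, hy0, hyN⟩ := Nat.find_spec hex
  have hmin : ∀ y' ∈ I, (e y').support.card < (e y).support.card → y' = 0 := by
    intro y' hy' hlt
    by_contra h0
    exact Nat.find_min hex (hyN ▸ hlt) ⟨y', hy', h0, rfl⟩
  obtain ⟨i0, hi0⟩ : ∃ i, e y i ≠ 0 := by
    by_contra h
    push Not at h
    apply hy0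
    apply e.injective
    ext i
    simp [h]
  let T : TwoSidedIdeal Q := TwoSidedIdeal.mk'
    {q | ∃ y' ∈ I, (∀ i, e y i = 0 → e y' i = 0) ∧ e y' i0 = q}
    ⟨0, I.zero_mem, by simp, by simp⟩
    (by
      rintro _ _ ⟨y1, h1, h1', rfl⟩ ⟨y2, h2, h2', rfl⟩
      exact ⟨y1 + y2, I.add_mem h1 h2, fun i hi => by simp [h1' i hi, h2' i hi], by simp⟩)
    (by
      rintro _ ⟨y1, h1, h1', rfl⟩
      exact ⟨-y1, I.neg_mem h1, fun i hi => by simp [h1' i hi], by simp⟩)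
    (by
      rintro a _ ⟨y1, h1, h1', rfl⟩
      exact ⟨(1 ⊗ₜ a) * y1, I.mul_mem_left _ _ h1, fun i hi => by simp [eL, h1' i hi], eL _ _ _⟩)
    (by
      rintro _ a ⟨y1, h1, h1', rfl⟩
      exact ⟨y1 * (1 ⊗ₜ a), I.mul_mem_right _ _ h1, fun i hi => by simp [eR, h1' i hi], eR _ _ _⟩)
  have h1T : (1 : Q) ∈ T := IsSimpleRing.one_mem_of_ne_zero_mem T hi0 (by
    rw [TwoSidedIdeal.mem_mk']
    exact ⟨y, hyI, fun _ h => h, rfl⟩)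
  rw [TwoSidedIdeal.mem_mk'] at h1T
  obtain ⟨z, hzI, hz, hz1⟩ := h1T
  have hcomm : ∀ q : Q, (1 ⊗ₜ q) * z - z * (1 ⊗ₜ q) = 0 := by
    intro q
    apply hmin _ (I.sub_mem (I.mul_mem_left _ _ hzI) (I.mul_mem_right _ _ hzI))
    apply Finset.card_lt_card
    rw [Finset.ssubset_iff_of_subset]
    · refine ⟨i0, by simpa using hi0, ?_⟩
      simp [eL, eR, hz1]
    · intro i
      simp only [Finsupp.mem_support_iff]
      intro h h'
      apply h
      simp [eL, eR, hz i h']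
  have hcen : ∀ i, ∃ t : K, algebraMap K Q t = e z i := by
    intro i
    apply hc
    rw [Subring.mem_center_iff]
    intro q
    have := congrArg (fun w => e w i) (hcomm q)
    simp only [map_sub, Finsupp.sub_apply, eL, eR, map_zero, Finsupp.zero_apply] at this
    exact sub_eq_zero.mp this
  choose t ht using hcen
  obtain ⟨l, hl⟩ : ∃ l : L, z = l ⊗ₜ 1 := by
    have hz' : z = e.symm (e z) := by simp
    refine ⟨∑ i ∈ (e z).support, t i • b i, ?_⟩
    conv_lhs => rw [hz']
    rw [TensorProduct.equivFinsuppOfBasisLeft_symm_apply, Finsupp.sum, TensorProduct.sum_tmul]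
    apply Finset.sum_congr rfl
    intro i _
    rw [← ht i, Algebra.algebraMap_eq_smul_one, TensorProduct.tmul_smul, TensorProduct.smul_tmul']
  have hl0 : l ≠ 0 := by
    rintro rfl
    rw [TensorProduct.zero_tmul] at hl
    rw [hl] at hz1
    simp at hz1
  rw [← I.one_mem_iff]
  have := I.mul_mem_left (l⁻¹ ⊗ₜ 1) _ hzI
  rw [hl, Algebra.TensorProduct.tmul_mul_tmul, inv_mul_cancel₀ hl0, one_mul] at this
  exact this

lemma exists_splitting (n : ℕ) (hn : 1 ≤ n) (K Q : Type) [Field K] [Ring Q] [Algebra K Q]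
    [IsSimpleRing Q] (hc : ∀ q ∈ Subring.center Q, ∃ t : K, algebraMap K Q t = q)
    (hd : Module.finrank K Q = n ^ 2) :
    ∃ g : Q →ₐ[K] Matrix (Fin n) (Fin n) (AlgebraicClosure K),
      Submodule.span (AlgebraicClosure K) (Set.range g) = ⊤ := by
  haveI : FiniteDimensional K Q := Module.finite_of_finrank_pos (by rw [hd]; positivity)
  let L := AlgebraicClosure K
  haveI := simple_baseChange K Q L hc
  obtain ⟨d, hd0, ⟨e⟩⟩ := IsSimpleRing.exists_algEquiv_matrix_of_isAlgClosed L (L ⊗[K] Q)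
  have h1 : Module.finrank L (L ⊗[K] Q) = n ^ 2 := by
    rw [Module.finrank_baseChange, hd]
  have h2 : d = n := by
    have := e.toLinearEquiv.finrank_eq
    rw [h1, Module.finrank_matrix] at this
    simp at this
    nlinarith [pow_left_injective (M := ℕ) (n := 2) (by norm_num) (show n ^ 2 = d ^ 2 by rw [this]; ring)]
  subst h2
  refine ⟨(e.toAlgHom.restrictScalars K).comp Algebra.TensorProduct.includeRight, ?_⟩
  rw [eq_top_iff]
  rintro x -
  obtain ⟨y, rfl⟩ := e.surjective x
  induction y using TensorProduct.induction_on with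
  | zero => simp
  | add x y hx hy => rw [map_add]; exact Submodule.add_mem _ hx hy
  | tmul l q =>
    have : l ⊗ₜ[K] q = l • ((1 : L) ⊗ₜ[K] q) := by rw [TensorProduct.smul_tmul']; simp
    rw [this, map_smul]
    exact Submodule.smul_mem _ _ (Submodule.subset_span ⟨q, by simp⟩)

def cap {B : Type*} [Ring B] {N : ℕ} (u v x : Fin N → B) : B :=
  ∑ σ : Equiv.Perm (Fin N), Equiv.Perm.sign σ • (List.ofFn fun i => u i * x (σ i) * v i).prod

lemma cap_map {B B' : Type*} [Ring B] [Ring B'] (f : B →+* B') {N : ℕ} (u v x : Fin N → B) :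
    f (cap u v x) = cap (fun i => f (u i)) (fun i => f (v i)) (fun i => f (x i)) := by
  unfold cap
  rw [map_sum]
  refine Finset.sum_congr rfl fun σ _ => ?_
  rw [Units.smul_def, Units.smul_def, map_zsmul, map_list_prod, List.map_ofFn]
  congr 3
  ext i
  simp

def capX (C : Type*) {B : Type*} [CommRing C] [Ring B] [Algebra C B] {N : ℕ} (u v : Fin N → B) :
    B [⋀^Fin N]→ₗ[C] B :=
  MultilinearMap.alternatization ((MultilinearMap.mkPiAlgebraFin C N B).compLinearMap
    (fun i => LinearMap.mulLeftRight C (u i, v i)))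

lemma capX_apply (C : Type*) {B : Type*} [CommRing C] [Ring B] [Algebra C B] {N : ℕ}
    (u v x : Fin N → B) : capX C u v x = cap u v x := by
  simp [capX, cap, MultilinearMap.alternatization_apply, MultilinearMap.mkPiAlgebraFin_apply]

lemma alt_trace {C M ι : Type*} [CommRing C] [AddCommGroup M] [Module C M] [Fintype ι]
    [DecidableEq ι] (b : Module.Basis ι C M) (F : M [⋀^ι]→ₗ[C] C) (T : M →ₗ[C] M) (x : ι → M) :
    ∑ i, F (Function.update x i (T (x i))) = LinearMap.trace C M T * F x := by
  rw [AlternatingMap.eq_smul_basis_det b F]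
  simp only [AlternatingMap.smul_apply, smul_eq_mul, Module.Basis.det_apply,
    Module.Basis.toMatrix_update]
  rw [← Finset.mul_sum]
  have h1 : ∀ i, ((b.toMatrix x).updateCol i (b.repr (T (x i)))).det =
      ((b.toMatrix x).adjugate * (LinearMap.toMatrix b b T * b.toMatrix x)) i i := by
    intro i
    rw [← Matrix.cramer_apply, Matrix.cramer_eq_adjugate_mulVec, Matrix.mul_apply]
    refine Finset.sum_congr rfl fun j _ => ?_
    congr 1
    have := LinearMap.toMatrix_mulVec_repr b b T (x i)
    rw [← this]
    rfl
  simp only [h1]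
  have h2 : ∑ i, ((b.toMatrix x).adjugate * (LinearMap.toMatrix b b T * b.toMatrix x)) i i =
      LinearMap.trace C M T * (b.toMatrix x).det := by
    change Matrix.trace _ = _
    rw [Matrix.trace_mul_comm, Matrix.mul_assoc, Matrix.mul_adjugate,
      LinearMap.trace_eq_matrix_trace C b T]
    simp [mul_comm]
  rw [h2]
  ring

lemma trace_mulLeft_matrix {C : Type*} [CommRing C] (n : ℕ) (z : Matrix (Fin n) (Fin n) C) :
    LinearMap.trace C _ (LinearMap.mulLeft C z) = n * Matrix.trace z := by
  classical
  rw [LinearMap.trace_eq_matrix_trace C (Matrix.stdBasis C (Fin n) (Fin n))]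
  simp only [Matrix.trace, Matrix.diag, LinearMap.toMatrix_apply]
  rw [Fintype.sum_prod_type, Finset.mul_sum]
  refine Finset.sum_congr rfl fun i _ => ?_
  have : ∀ j, ((Matrix.stdBasis C (Fin n) (Fin n)).repr
      (LinearMap.mulLeft C z (Matrix.stdBasis C (Fin n) (Fin n) (i, j)))) (i, j) = z i i := by
    intro j
    rw [Matrix.stdBasis_eq_single]
    have h : ∀ y : Matrix (Fin n) (Fin n) C, (Matrix.stdBasis C (Fin n) (Fin n)).repr y (i, j)
      = y i j := fun y => by simp [Matrix.stdBasis]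
    rw [h]
    simp
  rw [Finset.sum_congr rfl fun j _ => this j]
  simp

lemma cap_trace {C : Type*} [CommRing C] (n : ℕ)
    (u v x : Fin (n * n) → Matrix (Fin n) (Fin n) C) (z : Matrix (Fin n) (Fin n) C) :
    ∑ i, cap u v (Function.update x i (z * x i)) = ((n : C) * Matrix.trace z) • cap u v x := by
  ext p q
  have := alt_trace ((Matrix.stdBasis C (Fin n) (Fin n)).reindex finProdFinEquiv)
    ((Matrix.entryLinearMap C C p q).compAlternatingMap (capX C u v)) (LinearMap.mulLeft C z) x
  rw [trace_mulLeft_matrix] at this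
  simpa [capX_apply, Matrix.sum_apply] using this

def opOf {B : Type*} [Ring B] (l : List (B × B)) (z : B) : B :=
  (l.map fun p => p.1 * z * p.2).sum

lemma opOf_append {B : Type*} [Ring B] (l l' : List (B × B)) (z : B) :
    opOf (l ++ l') z = opOf l z + opOf l' z := by simp [opOf]

lemma opOf_cons {B : Type*} [Ring B] (p : B × B) (l : List (B × B)) (z : B) :
    opOf (p :: l) z = p.1 * z * p.2 + opOf l z := by simp [opOf]

def IsOp {B : Type*} [Ring B] (A : Subring B) (F : B → B) : Prop :=
  ∃ l : List (B × B), (∀ p ∈ l, p.1 ∈ A ∧ p.2 ∈ A) ∧ ∀ z, opOf l z = F z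

lemma IsOp.single {B : Type*} [Ring B] {A : Subring B} {a b : B} (ha : a ∈ A) (hb : b ∈ A) :
    IsOp A (fun z => a * z * b) :=
  ⟨[(a, b)], by simp [ha, hb], by simp [opOf]⟩

lemma IsOp.zero {B : Type*} [Ring B] {A : Subring B} : IsOp A (fun _ => 0) :=
  ⟨[], by simp, by simp [opOf]⟩

lemma IsOp.add {B : Type*} [Ring B] {A : Subring B} {F G : B → B} (hF : IsOp A F)
    (hG : IsOp A G) : IsOp A (fun z => F z + G z) := by
  obtain ⟨l, hl, hl'⟩ := hF
  obtain ⟨l2, hl2, hl2'⟩ := hG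
  refine ⟨l ++ l2, ?_, fun z => by rw [opOf_append, hl', hl2']⟩
  intro p hp
  rcases List.mem_append.mp hp with h | h
  · exact hl p h
  · exact hl2 p h

lemma IsOp.sum {B ι : Type*} [Ring B] {A : Subring B} (s : Finset ι) {F : ι → B → B}
    (hF : ∀ i, IsOp A (F i)) : IsOp A (fun z => ∑ i ∈ s, F i z) := by
  classical
  induction s using Finset.induction_on with
  | empty => simpa using IsOp.zero
  | insert i s hi ih =>
    simp only [Finset.sum_insert hi]
    exact (hF i).add ih

lemma IsOp.comp_single {B : Type*} [Ring B] {A : Subring B} {F : B → B} (hF : IsOp A F) {a b : B}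
    (ha : a ∈ A) (hb : b ∈ A) : IsOp A (fun z => a * F z * b) := by
  obtain ⟨l, hl, hl'⟩ := hF
  refine ⟨l.map fun p => (a * p.1, p.2 * b), ?_, ?_⟩
  · intro p hp
    obtain ⟨q, hq, rfl⟩ := List.mem_map.mp hp
    exact ⟨A.mul_mem ha (hl q hq).1, A.mul_mem (hl q hq).2 hb⟩
  · intro z
    beta_reduce
    rw [← hl' z]
    clear hl hl'
    induction l with
    | nil => simp [opOf]
    | cons p l ih => rw [List.map_cons, opOf_cons, ih, opOf_cons]; noncomm_ring

lemma IsOp.comp {B : Type*} [Ring B] {A : Subring B} {F G : B → B} (hF : IsOp A F)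
    (hG : IsOp A G) : IsOp A (fun z => F (G z)) := by
  obtain ⟨l, hl, hl'⟩ := hF
  have : (fun z => F (G z)) = fun z => opOf l (G z) := by ext z; rw [hl']
  rw [this]
  clear hl' this
  induction l with
  | nil => simpa [opOf] using IsOp.zero
  | cons p l ih =>
    simp only [opOf_cons]
    exact (hG.comp_single (hl p (by simp)).1 (hl p (by simp)).2).add
      (ih fun q hq => hl q (by simp [hq]))

lemma prod_update {B : Type*} [Ring B] (A : Subring B) {N : ℕ} (g : Fin N → B)
    (hg : ∀ i, g i ∈ A) (j : Fin N) :
    ∃ a ∈ A, ∃ b ∈ A, ∀ h, (List.ofFn (Function.update g j h)).prod = a * h * b := by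
  induction N with
  | zero => exact j.elim0
  | succ N ih =>
    refine Fin.cases ?_ (fun j => ?_) j
    · refine ⟨1, A.one_mem, (List.ofFn (fun i : Fin N => g i.succ)).prod,
        A.list_prod_mem (by simpa [List.mem_ofFn] using fun i => hg _), fun h => ?_⟩
      simp [List.ofFn_succ]
    · obtain ⟨a, ha, b, hb, hab⟩ := ih (fun i => g i.succ) (fun i => hg _) j
      refine ⟨g 0 * a, A.mul_mem (hg 0) ha, b, hb, fun h => ?_⟩
      rw [List.ofFn_succ, List.prod_cons]
      have : (fun i : Fin N => Function.update g j.succ h i.succ) =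
          Function.update (fun i : Fin N => g i.succ) j h := by
        ext i
        by_cases hij : i = j
        · subst hij; simp
        · rw [Function.update_of_ne hij, Function.update_of_ne (by simpa using hij)]
      rw [this, hab, Function.update_of_ne (Fin.succ_ne_zero j).symm]
      noncomm_ring

lemma isOp_cap {B : Type*} [Ring B] (A : Subring B) {N : ℕ} (u v x : Fin N → B)
    (hu : ∀ i, u i ∈ A) (hv : ∀ i, v i ∈ A) (hx : ∀ i, x i ∈ A) :
    IsOp A (fun z => ∑ i, cap u v (Function.update x i (z * x i))) := by
  refine IsOp.sum _ fun i => ?_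
  unfold cap
  refine IsOp.sum _ fun σ => ?_
  obtain ⟨a, ha, b, hb, hab⟩ := prod_update A (fun j => u j * x (σ j) * v j)
    (fun j => A.mul_mem (A.mul_mem (hu _) (hx _)) (hv _)) (σ.symm i)
  have : (fun z => Equiv.Perm.sign σ •
      (List.ofFn fun j => u j * Function.update x i (z * x i) (σ j) * v j).prod) =
      fun z => (((Equiv.Perm.sign σ : ℤ) : B) * a * u (σ.symm i)) * z *
        (x i * v (σ.symm i) * b) := by
    ext z
    have h2 : (fun j => u j * Function.update x i (z * x i) (σ j) * v j) =
        Function.update (fun j => u j * x (σ j) * v j) (σ.symm i)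
          (u (σ.symm i) * (z * x i) * v (σ.symm i)) := by
      ext j
      by_cases hj : j = σ.symm i
      · subst hj; simp
      · rw [Function.update_of_ne hj, Function.update_of_ne]
        rintro rfl
        simp at hj
    rw [h2, hab, Units.smul_def, zsmul_eq_mul]
    noncomm_ring
  rw [this]
  exact IsOp.single (A.mul_mem (A.mul_mem (intCast_mem A _) ha) (hu _))
    (A.mul_mem (A.mul_mem (hx _) (hv _)) hb)

lemma trace_opOf_swap {C : Type*} [CommRing C] {n : ℕ}
    (l : List (Matrix (Fin n) (Fin n) C × Matrix (Fin n) (Fin n) C))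
    (z y : Matrix (Fin n) (Fin n) C) :
    Matrix.trace (opOf (l.map Prod.swap) z * y) = Matrix.trace (z * opOf l y) := by
  induction l with
  | nil => simp [opOf]
  | cons p l ih =>
    rw [List.map_cons, opOf_cons, opOf_cons, add_mul, mul_add, Matrix.trace_add, Matrix.trace_add,
      ih]
    congr 1
    simp only [Prod.fst_swap, Prod.snd_swap]
    rw [Matrix.mul_assoc, Matrix.mul_assoc, Matrix.trace_mul_comm]
    simp only [Matrix.mul_assoc]

lemma theta_op {C : Type*} [CommRing C] (n : ℕ) (A : Subring (Matrix (Fin n) (Fin n) C))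
    (u v x : Fin (n * n) → Matrix (Fin n) (Fin n) C)
    (hu : ∀ i, u i ∈ A) (hv : ∀ i, v i ∈ A) (hx : ∀ i, x i ∈ A) :
    IsOp A (fun z => ((n : C) * n * Matrix.trace (cap u v x * cap u v x) * Matrix.trace z) •
      (1 : Matrix (Fin n) (Fin n) C)) := by
  have h1 := isOp_cap A u v x hu hv hx
  simp only [cap_trace] at h1
  have h2 : IsOp A (fun z => ((n : C) * Matrix.trace (z * cap u v x)) •
      (1 : Matrix (Fin n) (Fin n) C)) := by
    obtain ⟨l, hl, hl'⟩ := h1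
    refine ⟨l.map Prod.swap, ?_, ?_⟩
    · intro p hp
      obtain ⟨q, hq, rfl⟩ := List.mem_map.mp hp
      exact ⟨(hl q hq).2, (hl q hq).1⟩
    · intro z
      rw [Matrix.ext_iff_trace_mul_right]
      intro y
      rw [trace_opOf_swap, hl']
      simp
      ring
  have h3 := h2.comp h1
  convert h3 using 2 with z
  congr 1
  simp
  ring

lemma cap_single {C : Type*} [CommRing C] (n : ℕ) (hn : 1 ≤ n) :
    cap (fun i : Fin (n * n) => Matrix.single (⟨0, hn⟩ : Fin n) (finProdFinEquiv.symm i).1 (1 : C))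
      (fun i => Matrix.single (finProdFinEquiv.symm i).2 (⟨0, hn⟩ : Fin n) (1 : C))
      (fun i => Matrix.single (finProdFinEquiv.symm i).1 (finProdFinEquiv.symm i).2 (1 : C)) =
    Matrix.single (⟨0, hn⟩ : Fin n) (⟨0, hn⟩ : Fin n) (1 : C) := by
  unfold cap
  rw [Finset.sum_eq_single 1]
  · have : IsIdempotentElem (Matrix.single (⟨0, hn⟩ : Fin n) (⟨0, hn⟩ : Fin n) (1 : C)) := by
      simp [IsIdempotentElem]
    simp [List.ofFn_const, this.pow_eq, (show n ≠ 0 by omega)]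
  · intro σ _ hσ
    obtain ⟨i, hi⟩ : ∃ i, σ i ≠ i := by
      by_contra h
      push Not at h
      exact hσ (Equiv.ext h)
    rw [List.prod_eq_zero, smul_zero]
    rw [List.mem_ofFn]
    refine ⟨i, ?_⟩
    have : finProdFinEquiv.symm (σ i) ≠ finProdFinEquiv.symm i :=
      fun h => hi (finProdFinEquiv.symm.injective h)
    beta_reduce
    by_cases h1 : (finProdFinEquiv.symm i).1 = (finProdFinEquiv.symm (σ i)).1
    · have h2 : (finProdFinEquiv.symm (σ i)).2 ≠ (finProdFinEquiv.symm i).2 :=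
        fun h => this (Prod.ext h1.symm h)
      rw [Matrix.mul_assoc, Matrix.single_mul_single_of_ne (h := h2), Matrix.mul_zero]
    · rw [Matrix.single_mul_single_of_ne (h := h1), Matrix.zero_mul]
  · simp

lemma cap_ne_zero_of_basis {L : Type*} [Field L] (n : ℕ) (hn : 1 ≤ n)
    (β : Module.Basis (Fin (n * n)) L (Matrix (Fin n) (Fin n) L)) :
    ∃ u v x : Fin (n * n) → Fin (n * n),
      cap (fun i => β (u i)) (fun i => β (v i)) (fun i => β (x i)) ≠ 0 := by
  by_contra! h
  have h1 : ∀ (u v : Fin (n * n) → Fin (n * n)) (x : Fin (n * n) → Matrix (Fin n) (Fin n) L),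
      cap (fun i => β (u i)) (fun i => β (v i)) x = 0 := by
    intro u v x
    have : (capX L (fun i => β (u i)) (fun i => β (v i))).toMultilinearMap = 0 := by
      apply Module.Basis.ext_multilinear (fun _ => β)
      intro w
      exact (capX_apply L _ _ _).trans (h u v w)
    have h2 := congrArg (fun F => F x) this
    exact (capX_apply L _ _ _).symm.trans h2
  have h2 : ∀ (u : Fin (n * n) → Fin (n * n)) (v x : Fin (n * n) → Matrix (Fin n) (Fin n) L),
      cap (fun i => β (u i)) v x = 0 := by
    intro u v x
    let F : MultilinearMap L (fun _ : Fin (n * n) => Matrix (Fin n) (Fin n) L)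
      (Matrix (Fin n) (Fin n) L) := ∑ σ : Equiv.Perm (Fin (n * n)), Equiv.Perm.sign σ •
        (MultilinearMap.mkPiAlgebraFin L (n * n) (Matrix (Fin n) (Fin n) L)).compLinearMap
          (fun i => LinearMap.mulLeft L (β (u i) * x (σ i)))
    have hF : ∀ w, F w = cap (fun i => β (u i)) w x := by
      intro w
      simp [F, cap, MultilinearMap.mkPiAlgebraFin_apply, mul_assoc]
    have : F = 0 := by
      apply Module.Basis.ext_multilinear (fun _ => β)
      intro w
      rw [hF]
      exact h1 u w x
    rw [← hF, this]; rfl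
  have h3 : ∀ (u v x : Fin (n * n) → Matrix (Fin n) (Fin n) L), cap u v x = 0 := by
    intro u v x
    let F : MultilinearMap L (fun _ : Fin (n * n) => Matrix (Fin n) (Fin n) L)
      (Matrix (Fin n) (Fin n) L) := ∑ σ : Equiv.Perm (Fin (n * n)), Equiv.Perm.sign σ •
        (MultilinearMap.mkPiAlgebraFin L (n * n) (Matrix (Fin n) (Fin n) L)).compLinearMap
          (fun i => LinearMap.mulRight L (x (σ i) * v i))
    have hF : ∀ w, F w = cap w v x := by
      intro w
      simp [F, cap, MultilinearMap.mkPiAlgebraFin_apply, mul_assoc]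
    have : F = 0 := by
      apply Module.Basis.ext_multilinear (fun _ => β)
      intro w
      rw [hF]
      exact h2 w v x
    rw [← hF, this]; rfl
  have := cap_single (C := L) n hn
  rw [h3] at this
  have h4 := congrFun (congrFun this ⟨0, hn⟩) ⟨0, hn⟩
  simp at h4

lemma opOf_map {B B' : Type*} [Ring B] [Ring B'] (f : B →+* B') (l : List (B × B)) (z : B) :
    f (opOf l z) = opOf (l.map fun p => (f p.1, f p.2)) (f z) := by
  simp [opOf, map_list_sum, Function.comp_def]

lemma opOf_add {B : Type*} [Ring B] (l : List (B × B)) (y z : B) :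
    opOf l (y + z) = opOf l y + opOf l z := by
  induction l with
  | nil => simp [opOf]
  | cons p l ih => rw [opOf_cons, opOf_cons, opOf_cons, ih]; noncomm_ring

lemma opOf_smul {K B : Type*} [Field K] [Ring B] [Algebra K B] (l : List (B × B)) (t : K) (z : B) :
    opOf l (t • z) = t • opOf l z := by
  induction l with
  | nil => simp [opOf]
  | cons p l ih => rw [opOf_cons, opOf_cons, ih]; simp

lemma opOf_sum {B ι : Type*} [Ring B] (l : List (B × B)) (s : Finset ι) (z : ι → B) :
    opOf l (∑ i ∈ s, z i) = ∑ i ∈ s, opOf l (z i) := by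
  classical
  induction s using Finset.induction_on with
  | empty => simp [opOf]
  | insert i s hi ih => rw [Finset.sum_insert hi, Finset.sum_insert hi, opOf_add, ih]

lemma opOf_mem_ideal {B : Type*} [Ring B] (I : TwoSidedIdeal B) (l : List (B × B)) (z : B)
    (hz : z ∈ I) : opOf l z ∈ I := by
  induction l with
  | nil => simpa [opOf] using I.zero_mem
  | cons p l ih =>
    rw [opOf_cons]
    exact I.add_mem (I.mul_mem_right _ _ (I.mul_mem_left _ _ hz)) ih

lemma csa_core (n : ℕ) (R Q K : Type) [Ring R] [Ring Q] [Nontrivial Q] [Field K] [Algebra K Q]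
    (f : R →+* Q) (hf : Function.Injective f) (κ : Subring.center R →+* K)
    (hκf : ∀ c, algebraMap K Q (κ c) = f (c : R))
    (hκ : Function.Injective κ)
    (hfrac : ∀ q : Q, ∃ r : R, ∃ c : Subring.center R, c ≠ 0 ∧ q * f (c : R) = f r)
    (l : List (R × R)) (x : Fin (n * n) → R)
    (M : Matrix (Fin (n * n)) (Fin (n * n)) (Subring.center R))
    (hM : ∀ i j, (M i j : R) = opOf l (x i * x j)) (hD : M.det ≠ 0)
    (hspan : ∀ r : R, ∃ t : Fin (n * n) → Subring.center R,
      (M.det : R) * r = ∑ i, (t i : R) * x i) :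
    IsSimpleRing Q ∧ (algebraMap K Q).range = Subring.center Q ∧ Module.finrank K Q = n ^ 2 := by
  have hK : ∀ c : Subring.center R, c ≠ 0 → κ c ≠ 0 := fun c hc h => hc (hκ (by rw [h, map_zero]))
  have hfrac' : ∀ q : Q, ∃ r : R, ∃ c : Subring.center R, c ≠ 0 ∧ q = (κ c)⁻¹ • f r := by
    intro q
    obtain ⟨r, c, hc, h⟩ := hfrac q
    refine ⟨r, c, hc, ?_⟩
    rw [← h, ← hκf, ← Algebra.commutes, ← Algebra.smul_def, smul_smul, inv_mul_cancel₀ (hK c hc),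
      one_smul]
  let L := l.map fun p => (f p.1, f p.2)
  have hcore : ∀ (t : Fin (n * n) → K) j, opOf L (f (x j) * ∑ i, t i • f (x i)) =
      algebraMap K Q ((M.map κ).mulVec t j) := by
    intro t j
    rw [Finset.mul_sum, opOf_sum, Matrix.mulVec, dotProduct, map_sum]
    refine Finset.sum_congr rfl fun i _ => ?_
    rw [mul_smul_comm, opOf_smul, ← map_mul, ← opOf_map, ← hM, ← hκf, Matrix.map_apply, map_mul,
      ← Algebra.commutes, Algebra.smul_def]
  have hdet : (M.map κ).det ≠ 0 := by
    have : (M.map κ).det = κ M.det := by rw [RingHom.map_det]; rfl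
    rw [this]; exact hK _ hD
  have hsp : ∀ q : Q, ∃ t : Fin (n * n) → K, q = ∑ i, t i • f (x i) := by
    intro q
    obtain ⟨r, c, hc, rfl⟩ := hfrac' q
    obtain ⟨t, ht⟩ := hspan r
    refine ⟨fun i => (κ c)⁻¹ * (κ M.det)⁻¹ * κ (t i), ?_⟩
    have h1 := congrArg f ht
    rw [map_mul, ← hκf, ← Algebra.smul_def] at h1
    have h2 : f r = (κ M.det)⁻¹ • ∑ i, κ (t i) • f (x i) := by
      rw [← inv_smul_smul₀ (hK _ hD) (f r), h1]
      congr 1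
      rw [map_sum]
      refine Finset.sum_congr rfl fun i _ => ?_
      rw [map_mul, ← hκf, Algebra.smul_def]
    rw [h2, smul_smul, Finset.smul_sum]
    simp only [smul_smul]
  have hli : LinearIndependent K fun i => f (x i) := by
    rw [Fintype.linearIndependent_iff]
    intro t ht i
    have : (M.map κ).mulVec t = 0 := by
      ext j
      have := hcore t j
      rw [ht] at this
      apply (algebraMap K Q).injective
      rw [← this]
      simp [opOf]
    exact congrFun (Matrix.eq_zero_of_mulVec_eq_zero hdet this) i
  refine ⟨?_, ?_, ?_⟩
  · apply IsSimpleRing.of_eq_bot_or_eq_top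
    intro I
    by_cases hI : I = ⊥
    · exact Or.inl hI
    right
    obtain ⟨q, hq, hq0⟩ : ∃ q ∈ I, q ≠ 0 := by
      by_contra! h
      apply hI
      ext y
      constructor
      · intro hy; rw [h y hy]; exact TwoSidedIdeal.zero_mem _
      · intro hy
        have : y = 0 := hy
        rw [this]; exact I.zero_mem
    obtain ⟨t, ht⟩ := hsp q
    obtain ⟨j, hj⟩ : ∃ j, (M.map κ).mulVec t j ≠ 0 := by
      by_contra! h
      have := Matrix.eq_zero_of_mulVec_eq_zero hdet (funext h)
      apply hq0
      rw [ht, this]; simp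
    have h1 := opOf_mem_ideal I L _ (I.mul_mem_left (f (x j)) _ hq)
    rw [ht, hcore] at h1
    have h2 := I.mul_mem_left (algebraMap K Q ((M.map κ).mulVec t j)⁻¹) _ h1
    rw [← map_mul, inv_mul_cancel₀ hj, map_one] at h2
    exact I.one_mem_iff.mp h2
  · ext q
    constructor
    · rintro ⟨t, rfl⟩
      rw [Subring.mem_center_iff]
      intro y
      exact (Algebra.commutes t y).symm
    · intro hq
      obtain ⟨r, c, hc, rfl⟩ := hfrac' q
      have hr : r ∈ Subring.center R := by
        rw [Subring.mem_center_iff] at hq ⊢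
        intro y
        apply hf
        have := hq (f y)
        rw [mul_smul_comm, smul_mul_assoc] at this
        have := congrArg (fun z => κ c • z) this
        simpa [smul_smul, hK c hc] using this
      refine ⟨(κ c)⁻¹ * κ ⟨r, hr⟩, ?_⟩
      rw [map_mul, hκf, Algebra.smul_def]
  · let b := Module.Basis.mk hli (by
      rintro q -
      obtain ⟨t, rfl⟩ := hsp q
      exact Submodule.sum_mem _ fun i _ => Submodule.smul_mem _ _ (Submodule.subset_span ⟨i, rfl⟩))
    rw [Module.finrank_eq_card_basis b, Fintype.card_fin, sq]

lemma piDegree_core (n : ℕ) (R : Type) [Ring R] (hR : IsPrimeRing R)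
    (l : List (R × R)) (x : Fin (n * n) → R)
    (M : Matrix (Fin (n * n)) (Fin (n * n)) (Subring.center R))
    (hM : ∀ i j, (M i j : R) = opOf l (x i * x j)) (hD : M.det ≠ 0)
    (hspan : ∀ r : R, ∃ t : Fin (n * n) → Subring.center R,
      (M.det : R) * r = ∑ i, (t i : R) * x i) :
    HasPIDegree n R := by
  obtain ⟨hnt, hp⟩ := hR
  let Z := Subring.center R
  have hreg : ∀ (c : Z) (r : R), (c : R) * r = 0 → c = 0 ∨ r = 0 := by
    intro c r h
    have := hp c r (fun y => by
      rw [← (Subring.mem_center_iff.mp c.2 y), mul_assoc, h, mul_zero])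
    exact this.imp (fun h => Subtype.ext h) id
  haveI : NoZeroDivisors Z := ⟨fun {a b} h => by
    have := hreg a b (congrArg Subtype.val h)
    exact this.imp id (fun h => Subtype.ext h)⟩
  haveI : IsDomain Z := NoZeroDivisors.to_isDomain Z
  letI : Algebra Z R := (Subring.center R).subtype.toAlgebra'
    (fun c y => (Subring.mem_center_iff.mp c.2 y).symm)
  let S := nonZeroDivisors Z
  let K := FractionRing Z
  letI : Algebra K (LocalizedModule S R) := LocalizedModule.algebraOfIsLocalization K
  let f : R →+* LocalizedModule S R := LocalizedModule.numeratorRingHom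
  have hf : Function.Injective f := by
    intro a b hab
    obtain ⟨u, hu⟩ := LocalizedModule.mk_eq.mp hab
    have hu' : ((u : Z) : R) * (a - b) = 0 := by
      have : ((u : Z) : R) * ((1 : R) * a) = ((u : Z) : R) * ((1 : R) * b) := hu
      rw [mul_sub, sub_eq_zero]
      simpa using this
    rcases hreg _ _ hu' with h | h
    · exact absurd h (nonZeroDivisors.coe_ne_zero u)
    · exact sub_eq_zero.mp h
  haveI : Nontrivial (LocalizedModule S R) := hf.nontrivial
  have hκf : ∀ c : Z, algebraMap K (LocalizedModule S R) (algebraMap Z K c) = f (c : R) := by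
    intro c
    rw [← IsLocalization.mk'_one (M := S) K c, LocalizedModule.algebraMap_mk']
    rfl
  have hfrac : ∀ q : LocalizedModule S R, ∃ r : R, ∃ c : Z, c ≠ 0 ∧ q * f (c : R) = f r := by
    intro q
    induction q using LocalizedModule.induction_on with
    | h r s =>
      refine ⟨r, s, nonZeroDivisors.coe_ne_zero s, ?_⟩
      change LocalizedModule.mk r s * LocalizedModule.mk _ 1 = LocalizedModule.mk r 1
      rw [LocalizedModule.mk_mul_mk, LocalizedModule.mk_eq]
      refine ⟨1, ?_⟩
      change ((1 : Z) : R) * (((1 : Z) : R) * (r * ((s : Z) : R))) =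
        ((1 : Z) : R) * ((((s : Z) * 1 : Z) : R) * r)
      simp [Subring.mem_center_iff.mp (s : Z).2 r]
  obtain ⟨h1, h2, h3⟩ := csa_core n R (LocalizedModule S R) K f hf (algebraMap Z K) hκf
    (IsFractionRing.injective Z K) hfrac l x M hM hD hspan
  refine ⟨LocalizedModule S R, inferInstance, f, hf, ?_, ?_, h1, K, inferInstance, inferInstance,
    h2, h3⟩
  · intro c hc hc0
    have := hκf ⟨c, hc⟩
    rw [← this]
    apply RingHom.isUnit_map
    rw [isUnit_iff_ne_zero]
    intro h
    apply hc0
    have := (IsFractionRing.injective Z K) (h.trans (map_zero _).symm)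
    exact congrArg Subtype.val this
  · intro q
    obtain ⟨r, c, hc, h⟩ := hfrac q
    exact ⟨r, c, c.2, fun h => hc (Subtype.ext h), h⟩



lemma gram_identity {C : Type*} [CommRing C] (n : ℕ) (c : C)
    (X : Fin (n * n) → Matrix (Fin n) (Fin n) C)
    (hnd : ∀ y : Matrix (Fin n) (Fin n) C, (∀ j, c * (X j * y).trace = 0) → y = 0)
    (z : Matrix (Fin n) (Fin n) C) (M : Matrix (Fin (n * n)) (Fin (n * n)) C)
    (hM : ∀ i j, M i j = c * (X i * X j).trace) :
    M.det • z = ∑ i, (M.adjugate.mulVec fun j => c * (X j * z).trace) i • X i := by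
  rw [← sub_eq_zero]
  apply hnd
  intro j
  set w : Fin (n * n) → C := fun j => c * (X j * z).trace with hw
  have h1 : M.mulVec (M.adjugate.mulVec w) j = M.det * w j := by
    rw [Matrix.mulVec_mulVec, Matrix.mul_adjugate, Matrix.smul_mulVec, Matrix.one_mulVec]; rfl
  rw [mul_sub, Matrix.trace_sub, mul_sub, sub_eq_zero, mul_smul_comm, Matrix.trace_smul,
    smul_eq_mul, mul_left_comm, ← show w j = c * (X j * z).trace from rfl, ← h1,
    Matrix.mulVec, dotProduct, Finset.mul_sum, Matrix.trace_sum, Finset.mul_sum]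
  refine Finset.sum_congr rfl fun i _ => ?_
  rw [hM, mul_smul_comm, Matrix.trace_smul, smul_eq_mul]; ring

lemma trace_single_one_mul {C : Type*} [CommRing C] (n : ℕ) (p q : Fin n)
    (y : Matrix (Fin n) (Fin n) C) : (Matrix.single p q 1 * y).trace = y q p := by
  rw [Matrix.trace_single_mul]; simp

lemma nondeg_of_eval {C F : Type*} [CommRing C] [IsDomain C] [Field F] (e : C →+* F) (n : ℕ)
    (c : C) (hc : c ≠ 0) (X : Fin (n * n) → Matrix (Fin n) (Fin n) C)
    (hX : ∀ i, e.mapMatrix (X i) =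
      Matrix.single (finProdFinEquiv.symm i).1 (finProdFinEquiv.symm i).2 1)
    (y : Matrix (Fin n) (Fin n) C) (hy : ∀ j, c * (X j * y).trace = 0) : y = 0 := by
  let N : Matrix (Fin (n * n)) (Fin (n * n)) C := fun j l =>
    X j (finProdFinEquiv.symm l).1 (finProdFinEquiv.symm l).2
  have hN : N.det ≠ 0 := by
    intro h
    have h1 : e.mapMatrix N = 1 := by
      ext j l
      have := congrFun (congrFun (hX j) (finProdFinEquiv.symm l).1) (finProdFinEquiv.symm l).2
      change e (N j l) = _ at this
      change e (N j l) = _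
      rw [this, Matrix.single_apply, Matrix.one_apply]
      congr 1
      rw [← Prod.ext_iff, Equiv.apply_eq_iff_eq]
    have h2 := RingHom.map_det e N
    rw [h1, h, map_zero, Matrix.det_one] at h2
    exact zero_ne_one h2
  have h3 : N.mulVec (fun l => y (finProdFinEquiv.symm l).2 (finProdFinEquiv.symm l).1) = 0 := by
    ext j
    have h4 := (mul_eq_zero.mp (hy j)).resolve_left hc
    rw [Pi.zero_apply, ← h4, Matrix.mulVec, dotProduct, Matrix.trace,
      Fintype.sum_equiv finProdFinEquiv.symm _ (fun p : Fin n × Fin n => X j p.1 p.2 * y p.2 p.1)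
        (fun _ => rfl), Fintype.sum_prod_type]
    rfl
  have h5 := Matrix.eq_zero_of_mulVec_eq_zero hN h3
  ext p q
  have := congrFun h5 (finProdFinEquiv (q, p))
  simpa using this

lemma fwd_core (n : ℕ) (hn : 1 ≤ n) {C F : Type} [CommRing C] [IsDomain C] [Field F] [CharZero F]
    (e : C →+* F) (A : Type) [Ring A] (ι : A →+* Matrix (Fin n) (Fin n) C)
    (hι : Function.Injective ι)
    (hsurj : ∀ y : Matrix (Fin n) (Fin n) F, ∃ p : A, e.mapMatrix (ι p) = y)
    (R : Type) [Ring R] (hR : IsPrimeRing R) (π : A →+* R) (hπ : Function.Surjective π)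
    (hker : ∀ p, π p = 0 → e.mapMatrix (ι p) = 0) : HasPIDegree n R := by
  haveI : Nonempty (Fin n) := ⟨⟨0, hn⟩⟩
  choose s hs using hsurj
  let r := (finProdFinEquiv (m := n) (n := n)).symm
  let u : Fin (n * n) → A := fun i => s (Matrix.single ⟨0, hn⟩ (r i).1 1)
  let v : Fin (n * n) → A := fun i => s (Matrix.single (r i).2 ⟨0, hn⟩ 1)
  let X : Fin (n * n) → A := fun i => s (Matrix.single (r i).1 (r i).2 1)
  set c : C := (n : C) * n * (cap (fun i => ι (u i)) (fun i => ι (v i)) (fun i => ι (X i)) *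
    cap (fun i => ι (u i)) (fun i => ι (v i)) (fun i => ι (X i))).trace with hcdef
  have hec : e c ≠ 0 := by
    have h1 : e.mapMatrix (cap (fun i => ι (u i)) (fun i => ι (v i)) (fun i => ι (X i))) =
        Matrix.single ⟨0, hn⟩ ⟨0, hn⟩ 1 := by
      rw [cap_map]
      simp only [u, v, X, hs]
      exact cap_single n hn
    have h2 : ∀ y : Matrix (Fin n) (Fin n) C, e y.trace = (e.mapMatrix y).trace := by
      intro y; simp [Matrix.trace]
    rw [hcdef, map_mul, h2, map_mul, map_mul, h1]
    have : (n : F) ≠ 0 := by exact_mod_cast (by omega : n ≠ 0)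
    simp [this]
  have hc : c ≠ 0 := fun h => hec (by rw [h, map_zero])
  obtain ⟨l, hl, hl'⟩ := theta_op n ι.range (fun i => ι (u i)) (fun i => ι (v i))
    (fun i => ι (X i)) (fun i => ⟨_, rfl⟩) (fun i => ⟨_, rfl⟩) (fun i => ⟨_, rfl⟩)
  let pre : Matrix (Fin n) (Fin n) C → A := Function.invFun ι
  have hpre : ∀ b ∈ ι.range, ι (pre b) = b := fun b hb => Function.invFun_eq hb
  let l' : List (A × A) := l.map fun p => (pre p.1, pre p.2)
  have hθ : ∀ z : A, ι (opOf l' z) = Matrix.scalar (Fin n) (c * (ι z).trace) := by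
    intro z
    rw [opOf_map, List.map_map]
    have : l.map ((fun p => (ι p.1, ι p.2)) ∘ fun p => (pre p.1, pre p.2)) = l := by
      conv_rhs => rw [← List.map_id l]
      refine List.map_congr_left fun p hp => ?_
      exact Prod.ext (hpre _ (hl p hp).1) (hpre _ (hl p hp).2)
    rw [this, hl', Matrix.scalar_apply, ← Matrix.smul_one_eq_diagonal]
  let S : Subring C := ι.range.comap (Matrix.scalar (Fin n))
  have hS : ∀ t : S, ∃ p : A, ι p = Matrix.scalar (Fin n) (t : C) := fun t => t.2
  choose ch hch using hS
  have hch' : ∀ (t : S) (p : A), ι p = Matrix.scalar (Fin n) (t : C) → ch t = p :=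
    fun t p h => hι ((hch t).trans h.symm)
  have hcen : ∀ t, π (ch t) ∈ Subring.center R := by
    intro t
    rw [Subring.mem_center_iff]
    intro y
    obtain ⟨z, rfl⟩ := hπ y
    rw [← map_mul, ← map_mul]
    congr 1
    apply hι
    rw [map_mul, map_mul, hch]
    exact (Matrix.scalar_commute _ (fun _ => Commute.all _ _) _).symm
  let σ : S →+* Subring.center R :=
    { toFun := fun t => ⟨π (ch t), hcen t⟩
      map_one' := Subtype.ext (by
        change π (ch 1) = 1
        rw [hch' 1 1 (by simp), map_one])
      map_zero' := Subtype.ext (by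
        change π (ch 0) = 0
        rw [hch' 0 0 (by simp), map_zero])
      map_mul' := fun a b => Subtype.ext (by
        change π (ch (a * b)) = π (ch a) * π (ch b)
        rw [hch' (a * b) (ch a * ch b) (by rw [map_mul, hch, hch, ← map_mul]; rfl), map_mul])
      map_add' := fun a b => Subtype.ext (by
        change π (ch (a + b)) = π (ch a) + π (ch b)
        rw [hch' (a + b) (ch a + ch b) (by rw [map_add, hch, hch, ← map_add]; rfl), map_add]) }
  let θ : A → S := fun z => ⟨c * (ι z).trace, opOf l' z, hθ z⟩
  have hσθ : ∀ z, (σ (θ z) : R) = π (opOf l' z) := fun z =>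
    congrArg π (hch' (θ z) (opOf l' z) (hθ z))
  let M : Matrix (Fin (n * n)) (Fin (n * n)) S := fun i j => θ (X i * X j)
  have hMC : ∀ i j, S.subtype.mapMatrix M i j = c * (ι (X i) * ι (X j)).trace := by
    intro i j
    change c * (ι (X i * X j)).trace = _
    rw [map_mul]
  have hdetC : (M.det : C) = (S.subtype.mapMatrix M).det := RingHom.map_det S.subtype M
  have hdetσ : (σ.mapMatrix M).det = σ M.det := (RingHom.map_det σ M).symm
  have hX : ∀ i, e.mapMatrix (ι (X i)) =
      Matrix.single (finProdFinEquiv.symm i).1 (finProdFinEquiv.symm i).2 1 := fun i => hs _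
  have hedet : e (M.det : C) ≠ 0 := by
    rw [hdetC, RingHom.map_det]
    intro h0
    obtain ⟨t, ht, h⟩ := Matrix.exists_mulVec_eq_zero_iff.mpr h0
    apply ht
    ext i
    have h1 := congrFun h (finProdFinEquiv ((r i).2, (r i).1))
    have h2 : ∀ j i, e.mapMatrix (S.subtype.mapMatrix M) j i =
        e c * if (r i).1 = (r j).2 ∧ (r i).2 = (r j).1 then 1 else 0 := by
      intro j i
      change e (S.subtype.mapMatrix M j i) = _
      have h3 : ∀ y : Matrix (Fin n) (Fin n) C, e y.trace = (e.mapMatrix y).trace := by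
        intro y; simp [Matrix.trace]
      rw [hMC, map_mul e c, h3, map_mul e.mapMatrix, hX, hX, trace_single_one_mul, Matrix.single_apply]
    rw [Matrix.mulVec, dotProduct, Finset.sum_eq_single i, h2] at h1
    · simpa [r, hec] using h1
    · intro j _ hj
      rw [h2, if_neg, mul_zero, zero_mul]
      rintro ⟨h3, h4⟩
      apply hj
      apply r.injective
      simp only [r, Equiv.symm_apply_apply] at h3 h4
      exact Prod.ext h3 h4
    · simp
  refine piDegree_core n R hR (l'.map fun p => (π p.1, π p.2)) (fun i => π (X i)) (σ.mapMatrix M)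
    ?_ ?_ ?_
  · intro i j
    rw [← map_mul, ← opOf_map]
    exact hσθ _
  · rw [hdetσ]
    intro h
    have h1 : π (ch M.det) = 0 := congrArg Subtype.val h
    have h2 := hker _ h1
    rw [hch] at h2
    apply hedet
    have := congrFun (congrFun h2 ⟨0, hn⟩) ⟨0, hn⟩
    simpa using this
  · intro y
    obtain ⟨z, rfl⟩ := hπ y
    let t : Fin (n * n) → S := M.adjugate.mulVec fun j => θ (X j * z)
    refine ⟨fun i => σ (t i), ?_⟩
    rw [hdetσ]
    change π (ch M.det) * π z = ∑ i, π (ch (t i)) * π (X i)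
    simp only [← map_mul, ← map_sum]
    congr 1
    apply hι
    rw [map_mul, hch, map_sum]
    simp only [map_mul, hch]
    have key := gram_identity n c (fun i => ι (X i)) (nondeg_of_eval e n c hc _ hX) (ι z)
      (S.subtype.mapMatrix M) hMC
    have ht : ∀ i, (t i : C) = ((S.subtype.mapMatrix M).adjugate.mulVec
        fun j => c * (ι (X j) * ι z).trace) i := by
      intro i
      have h1 := RingHom.map_mulVec S.subtype M.adjugate (fun j => θ (X j * z)) i
      rw [← RingHom.map_adjugate]
      refine h1.trans ?_
      congr 1
      ext j
      change c * (ι (X j * z)).trace = _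
      rw [map_mul]
    have hsc : ∀ (a : C) (y : Matrix (Fin n) (Fin n) C), Matrix.scalar (Fin n) a * y = a • y := by
      intro a y; rw [Matrix.scalar_apply, ← Matrix.smul_one_eq_diagonal, smul_mul_assoc, one_mul]
    simp only [hsc, ht]
    rw [hdetC]
    exact key


lemma exists_rep (n : ℕ) (hn : 1 ≤ n) (R : Type) [Ring R] [Algebra k R] (h : HasPIDegree n R) :
    ∃ (L : Type) (_ : Field L) (_ : Algebra k L) (g : R →ₐ[k] Matrix (Fin n) (Fin n) L),
      Submodule.span L (Set.range g) = ⊤ := by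
  obtain ⟨Q, _, f, hf, hu, hq, hs, K, _, _, hc, hd⟩ := h
  have hcent : ∀ c ∈ Subring.center R, ∃ t : K, algebraMap K Q t = f c := by
    intro c hcc
    have : f c ∈ Subring.center Q := by
      rw [Subring.mem_center_iff] at hcc ⊢
      intro q
      obtain ⟨r, d, hd, hd0, h1⟩ := hq q
      have hun := hu d hd hd0
      apply hun.mul_right_cancel
      rw [mul_assoc, ← map_mul, hcc d |>.symm, map_mul, ← mul_assoc, h1, mul_assoc, h1,
        ← map_mul, ← map_mul, hcc r]
    rw [← hc] at this
    exact this
  have hinj : Function.Injective (algebraMap K Q) := (algebraMap K Q).injective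
  have hk : ∀ c : k, ∃ t : K, algebraMap K Q t = f (algebraMap k R c) := fun c =>
    hcent _ (Subring.mem_center_iff.mpr fun y => (Algebra.commutes c y).symm)
  choose ψ hψ using hk
  let Ψ : k →+* K :=
    { toFun := ψ
      map_one' := hinj (by rw [hψ]; simp)
      map_zero' := hinj (by rw [hψ]; simp)
      map_mul' := fun a b => hinj (by rw [hψ]; simp [hψ])
      map_add' := fun a b => hinj (by rw [hψ]; simp [hψ]) }
  obtain ⟨g, hg⟩ := exists_splitting n hn K Q (fun q hq => by rw [← hc] at hq; exact hq) hd
  letI : Algebra k (AlgebraicClosure K) := ((algebraMap K (AlgebraicClosure K)).comp Ψ).toAlgebra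
  refine ⟨AlgebraicClosure K, inferInstance, inferInstance,
    { g.toRingHom.comp f with
      commutes' := fun c => ?_ }, ?_⟩
  · change g (f (algebraMap k R c)) = _
    rw [← hψ, AlgHom.commutes]
    ext i j
    rw [Matrix.algebraMap_matrix_apply, Matrix.algebraMap_matrix_apply]
    rfl
  · rw [eq_top_iff, ← hg, Submodule.span_le]
    rintro _ ⟨q, rfl⟩
    obtain ⟨r, d, hd, hd0, h1⟩ := hq q
    obtain ⟨t, ht⟩ := hcent d hd
    have ht0 : t ≠ 0 := by
      rintro rfl
      have := hu d hd hd0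
      rw [← ht, map_zero] at this
      exact not_isUnit_zero this
    have h2 : q = t⁻¹ • f r := by
      rw [← h1, ← ht, ← Algebra.commutes, ← Algebra.smul_def, smul_smul, inv_mul_cancel₀ ht0,
        one_smul]
    rw [h2, map_smul, ← algebraMap_smul (AlgebraicClosure K)]
    exact Submodule.smul_mem _ _ (Submodule.subset_span ⟨r, rfl⟩)

lemma exists_basis {L B : Type} [Field L] (n : ℕ) (φ : B → Matrix (Fin n) (Fin n) L)
    (h : Submodule.span L (Set.range φ) = ⊤) :
    ∃ (β : Module.Basis (Fin (n * n)) L (Matrix (Fin n) (Fin n) L)) (x : Fin (n * n) → B),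
      ∀ i, β i = φ (x i) := by
  obtain ⟨b, hb, hsp, hli⟩ := exists_linearIndependent L (Set.range φ)
  let β0 := Module.Basis.mk hli (by rw [Subtype.range_coe, hsp, h])
  let e := β0.indexEquiv ((Matrix.stdBasis L (Fin n) (Fin n)).reindex finProdFinEquiv)
  have : ∀ i, ∃ x, (β0.reindex e) i = φ x := by
    intro i
    rw [Module.Basis.reindex_apply, Module.Basis.mk_apply]
    obtain ⟨x, hx⟩ := hb (e.symm i).2
    exact ⟨x, hx.symm⟩
  choose x hx using this
  exact ⟨_, x, hx⟩

lemma linInd_iff_det {F : Type} [Field F] (n : ℕ) (x : Fin (n * n) → Matrix (Fin n) (Fin n) F)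
    (N : Matrix (Fin (n * n)) (Fin (n * n)) F)
    (hN : ∀ i l, N i l = x i (finProdFinEquiv.symm l).1 (finProdFinEquiv.symm l).2) :
    LinearIndependent F x ↔ N.det ≠ 0 := by
  rw [← isUnit_iff_ne_zero, ← Matrix.isUnit_iff_isUnit_det, ← Matrix.linearIndependent_rows_iff_isUnit]
  let b := (Matrix.stdBasis F (Fin n) (Fin n)).reindex finProdFinEquiv
  have : N.row = b.equivFun.toLinearMap ∘ x := by
    funext i l
    change N i l = b.repr (x i) l
    rw [hN, Module.Basis.repr_reindex_apply, Matrix.stdBasis]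
    simp
  rw [this, LinearMap.linearIndependent_iff_of_injOn]
  exact b.equivFun.injective.injOn

lemma exists_point {σ L : Type} [Finite σ] [Field L] [Algebra k L] (ev : MvPolynomial σ k →ₐ[k] L)
    (E : MvPolynomial σ k) (hE : ev E ≠ 0) :
    ∃ a : σ → k, (∀ p, ev p = 0 → MvPolynomial.aeval a p = 0) ∧ MvPolynomial.aeval a E ≠ 0 := by
  by_contra! h
  apply hE
  have hp : (RingHom.ker ev).IsPrime := RingHom.ker_isPrime _
  have : E ∈ MvPolynomial.vanishingIdeal k (MvPolynomial.zeroLocus k (RingHom.ker ev)) := by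
    rw [MvPolynomial.mem_vanishingIdeal_iff]
    intro a ha
    exact h a (fun p hp => ha p hp)
  rw [MvPolynomial.IsPrime.vanishingIdeal_zeroLocus] at this
  exact this

def evOf {n m : ℕ} {L : Type} [Field L] [Algebra k L] {A : Subalgebra k (MatPoly k n m)}
    (hA : GMN k n m ≤ A) (φ : A →ₐ[k] Matrix (Fin n) (Fin n) L) : PolyRing k n m →ₐ[k] L :=
  MvPolynomial.aeval fun x : MIdx n m =>
    φ ⟨genericMatrix k n m x.1, hA (Algebra.subset_adjoin ⟨x.1, rfl⟩)⟩ x.2.1 x.2.2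

lemma agree_GMN {n m : ℕ} {L : Type} [Field L] [Algebra k L] {A : Subalgebra k (MatPoly k n m)}
    (hA : GMN k n m ≤ A) (φ : A →ₐ[k] Matrix (Fin n) (Fin n) L) :
    GMN k n m ≤ (AlgHom.equalizer φ ((evOf k hA φ).mapMatrix.comp A.val)).map A.val := by
  refine Algebra.adjoin_le ?_
  rintro _ ⟨h, rfl⟩
  refine ⟨⟨genericMatrix k n m h, hA (Algebra.subset_adjoin ⟨h, rfl⟩)⟩, ?_, rfl⟩
  change φ _ = (evOf k hA φ).mapMatrix (genericMatrix k n m h)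
  ext i j
  simp [evOf, genericMatrix]

lemma trace_rep {n m : ℕ} (hn : 1 ≤ n) {L : Type} [Field L] [Algebra k L]
    {A : Subalgebra k (MatPoly k n m)}
    (φ : A →ₐ[k] Matrix (Fin n) (Fin n) L) (hφ : Submodule.span L (Set.range φ) = ⊤)
    (z tz : A) (h : (tz : MatPoly k n m) = traceScalar k (z : MatPoly k n m)) :
    φ tz = Matrix.scalar (Fin n) (φ z).trace := by
  have : Nonempty (Fin n) := ⟨⟨0, hn⟩⟩
  have hch : CharZero L := charZero_of_injective_algebraMap (algebraMap k L).injective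
  have hn0 : (n : L) ≠ 0 := by exact_mod_cast (by omega : n ≠ 0)
  obtain ⟨β, y, hy⟩ := exists_basis n φ hφ
  obtain ⟨u, v, x, hne⟩ := cap_ne_zero_of_basis n hn β
  simp only [hy] at hne
  have hcm : ∀ w : Matrix (Fin n) (Fin n) L, Commute (φ tz) w := by
    intro w
    have hw : w ∈ Submodule.span L (Set.range φ) := by rw [hφ]; trivial
    induction hw using Submodule.span_induction with
    | mem w hw =>
      obtain ⟨p, rfl⟩ := hw
      have : tz * p = p * tz := by
        apply Subtype.ext
        change (tz : MatPoly k n m) * p = p * tz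
        rw [h, traceScalar]
        exact Algebra.commutes _ _
      exact (map_mul φ tz p).symm.trans ((congrArg φ this).trans (map_mul φ p tz))
    | zero => exact Commute.zero_right _
    | add a b _ _ ha hb => exact ha.add_right hb
    | smul c a _ ha => exact ha.smul_right c
  obtain ⟨t, ht⟩ : ∃ t, Matrix.scalar (Fin n) t = φ tz :=
    Matrix.mem_range_scalar_of_commute_single fun i j _ => (hcm _).symm
  -- the trace identity
  let U : Fin (n * n) → A := fun i => y (u i)
  let V : Fin (n * n) → A := fun i => y (v i)
  let X : Fin (n * n) → A := fun i => y (x i)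
  have h1 : ∑ i, cap U V (Function.update X i (z * X i)) = (n : A) * (tz * cap U V X) := by
    apply Subtype.ext
    have h2 := cap_trace n (fun i => (U i : MatPoly k n m)) (fun i => (V i : MatPoly k n m))
      (fun i => (X i : MatPoly k n m)) (z : MatPoly k n m)
    have h3 : ∀ X : Fin (n * n) → A, ((cap U V X : A) : MatPoly k n m) =
      cap (fun i => (U i : MatPoly k n m)) (fun i => (V i : MatPoly k n m))
      (fun i => (X i : MatPoly k n m)) := fun X => cap_map A.val.toRingHom U V X
    have h4 : ∀ i, (fun j => ((Function.update X i (z * X i) j : A) : MatPoly k n m)) =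
        Function.update (fun j => (X j : MatPoly k n m)) i (z * X i) := by
      intro i
      funext j
      by_cases hj : j = i
      · subst hj; simp
      · simp [Function.update_of_ne hj]
    rw [AddSubmonoidClass.coe_finsetSum]
    simp only [h3, h4]
    refine h2.trans ?_
    change _ = ((n : A) : MatPoly k n m) * ((tz : MatPoly k n m) * ((cap U V X : A) : MatPoly k n m))
    rw [h, h3, traceScalar, ← Algebra.smul_def, mul_smul]
    have : ((n : A) : MatPoly k n m) = (n : MatPoly k n m) := rfl
    rw [this, ← nsmul_eq_mul, ← Nat.cast_smul_eq_nsmul (PolyRing k n m)]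
  have h5 := congrArg φ h1
  rw [map_sum, map_mul, map_mul, map_natCast] at h5
  have h6 : ∀ X : Fin (n * n) → A, φ (cap U V X) =
      cap (fun i => φ (U i)) (fun i => φ (V i)) (fun i => φ (X i)) :=
    fun X => cap_map φ.toRingHom U V X
  have h7 : ∀ i, (fun j => φ (Function.update X i (z * X i) j)) =
      Function.update (fun j => φ (X j)) i (φ z * φ (X i)) := by
    intro i
    funext j
    by_cases hj : j = i
    · subst hj; simp
    · simp [Function.update_of_ne hj]
  simp only [h6, h7] at h5
  have h9 : ∀ Y : Matrix (Fin n) (Fin n) L, (n : Matrix (Fin n) (Fin n) L) * Y = (n : L) • Y := by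
    intro Y
    rw [← nsmul_eq_mul, Nat.cast_smul_eq_nsmul]
  rw [cap_trace, ← ht, Matrix.scalar_apply, ← Matrix.smul_one_eq_diagonal, smul_mul_assoc,
    one_mul, h9, smul_smul] at h5
  have h8 := smul_left_injective L hne h5
  rw [← ht, ← mul_left_cancel₀ hn0 h8]

lemma agree_TMN {n m : ℕ} (hn : 1 ≤ n) {L : Type} [Field L] [Algebra k L]
    (φ : TMN k n m →ₐ[k] Matrix (Fin n) (Fin n) L) (hφ : Submodule.span L (Set.range φ) = ⊤) :
    TMN k n m ≤ (AlgHom.equalizer φ ((evOf k (GMN_le_TMN k n m) φ).mapMatrix.comp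
      (TMN k n m).val)).map (TMN k n m).val := by
  conv_lhs => rw [TMN]
  refine Algebra.adjoin_le ?_
  rintro _ (h | ⟨z, hz, rfl⟩)
  · exact agree_GMN k (GMN_le_TMN k n m) φ h
  · have hmem : traceScalar k z ∈ TMN k n m := Algebra.subset_adjoin (Or.inr ⟨z, hz, rfl⟩)
    refine ⟨⟨traceScalar k z, hmem⟩, ?_, rfl⟩
    obtain ⟨z', hz', hzz⟩ := agree_GMN k (GMN_le_TMN k n m) φ hz
    change φ _ = (evOf k _ φ).mapMatrix (traceScalar k z)
    rw [trace_rep k hn φ hφ z' ⟨traceScalar k z, hmem⟩ 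
      (congrArg (traceScalar k) hzz.symm)]
    have h1 : φ z' = (evOf k (GMN_le_TMN k n m) φ).mapMatrix z := by
      rw [← hzz]; exact hz'
    have h2 : ((evOf k (GMN_le_TMN k n m) φ).mapMatrix z).trace =
        evOf k (GMN_le_TMN k n m) φ z.trace := by simp [Matrix.trace]
    rw [h1, h2]
    ext i j
    simp only [traceScalar, Matrix.scalar_apply, Matrix.diagonal_apply, AlgHom.mapMatrix_apply,
      Matrix.map_apply, Matrix.algebraMap_matrix_apply, Algebra.algebraMap_self, RingHom.id_apply]
    split_ifs <;> simp

lemma evalMat_generic {n m : ℕ} (a : MTuple k n m) (h : Fin m) :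
    evalMat k a (genericMatrix k n m h) = a h := by
  ext i j
  simp [evalMat, polyEval, genericMatrix]

lemma evalMat_GMN {n m : ℕ} (a : MTuple k n m) :
    (GMN k n m).map (evalMat k a) = Algebra.adjoin k (Set.range a) := by
  rw [GMN, AlgHom.map_adjoin, ← Set.range_comp]
  congr 2
  funext h
  exact evalMat_generic k a h

lemma evalMat_TMN {n m : ℕ} (a : MTuple k n m) :
    (TMN k n m).map (evalMat k a) ≤ Algebra.adjoin k (Set.range a) := by
  rw [TMN, AlgHom.map_adjoin, Algebra.adjoin_le_iff]
  rintro _ ⟨p, hp | ⟨z, hz, rfl⟩, rfl⟩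
  · rw [← evalMat_GMN]
    exact ⟨p, hp, rfl⟩
  · have : evalMat k a (traceScalar k z) = algebraMap k _ (polyEval k a z.trace) := by
      ext i j
      simp [traceScalar, evalMat, Matrix.algebraMap_matrix_apply]
      split_ifs <;> simp
    rw [this]
    exact Subalgebra.algebraMap_mem _ _

lemma bwd_core {n m : ℕ} (hn : 1 ≤ n) (A : Subalgebra k (MatPoly k n m)) (hA : GMN k n m ≤ A)
    (hev : ∀ a, A.map (evalMat k a) ≤ Algebra.adjoin k (Set.range a))
    (hag : ∀ (L : Type) (_ : Field L) (_ : Algebra k L) (φ : A →ₐ[k] Matrix (Fin n) (Fin n) L),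
      Submodule.span L (Set.range φ) = ⊤ →
      A ≤ (AlgHom.equalizer φ ((evOf k hA φ).mapMatrix.comp A.val)).map A.val)
    (J : TwoSidedIdeal A) (h : HasPIDegree n (idealQuot J)) : (zeroLocusI k J).Nonempty := by
  obtain ⟨L, _, _, g, hg⟩ := exists_rep k n hn (idealQuot J) h
  let π : A →ₐ[k] idealQuot J :=
    { J.ringCon.mk' with
      commutes' := fun c => rfl }
  have hπ : Function.Surjective π := J.ringCon.mk'_surjective
  let φ : A →ₐ[k] Matrix (Fin n) (Fin n) L := g.comp π
  have hφ : Submodule.span L (Set.range φ) = ⊤ := by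
    rw [← hg]
    congr 1
    exact hπ.range_comp g
  have hφe : ∀ p : A, φ p = (evOf k hA φ).mapMatrix (p : MatPoly k n m) := by
    intro p
    obtain ⟨q, hq, hqp⟩ := hag L _ _ φ hφ p.2
    have : q = p := Subtype.ext hqp
    subst this
    exact hq
  obtain ⟨β, x, hx⟩ := exists_basis n φ hφ
  let N : Matrix (Fin (n * n)) (Fin (n * n)) (PolyRing k n m) := fun i l =>
    (x i : MatPoly k n m) (finProdFinEquiv.symm l).1 (finProdFinEquiv.symm l).2
  have hE : evOf k hA φ N.det ≠ 0 := by
    rw [AlgHom.map_det]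
    refine (linInd_iff_det n β _ ?_).mp β.linearIndependent
    intro i l
    rw [hx, hφe]
    rfl
  obtain ⟨a, ha1, ha2⟩ := exists_point k (evOf k hA φ) N.det hE
  let a' : MTuple k n m := fun h i j => a (h, i, j)
  have hpe : polyEval k a' = MvPolynomial.aeval a := rfl
  refine ⟨a', ?_, ?_⟩
  · change Algebra.adjoin k (Set.range a') = ⊤
    rw [eq_top_iff]
    refine le_trans ?_ (hev a')
    have hli : LinearIndependent k fun i => evalMat k a' (x i : MatPoly k n m) := by
      rw [linInd_iff_det n _ ((polyEval k a').mapMatrix N) (fun i l => rfl), ← AlgHom.map_det, hpe]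
      exact ha2
    have hspan : Submodule.span k (Set.range fun i => evalMat k a' (x i : MatPoly k n m)) = ⊤ := by
      apply hli.span_eq_top_of_card_eq_finrank'
      rw [Module.finrank_matrix]; simp
    intro y _
    have hy : y ∈ Submodule.span k (Set.range fun i => evalMat k a' (x i : MatPoly k n m)) := by
      rw [hspan]; trivial
    have hle : Submodule.span k (Set.range fun i => evalMat k a' (x i : MatPoly k n m)) ≤
        Subalgebra.toSubmodule (A.map (evalMat k a')) := by
      rw [Submodule.span_le]
      rintro _ ⟨i, rfl⟩
      exact ⟨x i, (x i).2, rfl⟩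
    exact hle hy
  · intro p hp
    have h1 : φ p = 0 := by
      change g (π p) = 0
      have : π p = 0 := (RingCon.eq _).mpr ((TwoSidedIdeal.mem_iff _ _).mp hp)
      rw [this, map_zero]
    rw [hφe] at h1
    ext i j
    change polyEval k a' ((p : MatPoly k n m) i j) = 0
    rw [hpe]
    exact ha1 _ (congrFun (congrFun h1 i) j)

/-- **Statement 10** (Weak form of the Nullstellensatz,
Proposition prop.weak-null.prime).  Let `A` denote the algebra `G_{m,n}` or
`T_{m,n}`, and let `J` be a prime ideal of `A` (i.e. a two-sided ideal with
`A/J` a prime ring).  Then `Z(J) ≠ ∅` if and only if `A/J` has PI-degree `n`. -/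
theorem weak_nullstellensatz (n m : ℕ) (hn : 1 ≤ n) (hm : 2 ≤ m) :
    (∀ J : TwoSidedIdeal ↥(GMN k n m), IsPrimeRing (idealQuot J) →
      ((zeroLocusI k J).Nonempty ↔ HasPIDegree n (idealQuot J))) ∧
    (∀ J : TwoSidedIdeal ↥(TMN k n m), IsPrimeRing (idealQuot J) →
      ((zeroLocusI k J).Nonempty ↔ HasPIDegree n (idealQuot J))) := by
  have hsurjA : ∀ (A : Subalgebra k (MatPoly k n m)), GMN k n m ≤ A → ∀ J : TwoSidedIdeal A,
      IsPrimeRing (idealQuot J) → (zeroLocusI k J).Nonempty → HasPIDegree n (idealQuot J) := by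
    rintro A hA J hJ ⟨a, ha, hz⟩
    refine fwd_core n hn (polyEval k a).toRingHom A A.val.toRingHom Subtype.val_injective ?_ _ hJ
      J.ringCon.mk' J.ringCon.mk'_surjective ?_
    · intro y
      have hy : y ∈ (GMN k n m).map (evalMat k a) := by
        rw [evalMat_GMN, show Algebra.adjoin k (Set.range a) = ⊤ from ha]
        trivial
      obtain ⟨p, hp, rfl⟩ := hy
      exact ⟨⟨p, hA hp⟩, rfl⟩
    · intro p hp
      exact hz p ((TwoSidedIdeal.mem_iff _ _).mpr ((RingCon.eq _).mp hp))
  refine ⟨fun J hJ => ⟨hsurjA _ le_rfl J hJ, fun h => ?_⟩,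
    fun J hJ => ⟨hsurjA _ (GMN_le_TMN k n m) J hJ, fun h => ?_⟩⟩
  · exact bwd_core k hn _ le_rfl (fun a => (evalMat_GMN k a).le)
      (fun L _ _ φ _ => agree_GMN k le_rfl φ) J h
  · exact bwd_core k hn _ (GMN_le_TMN k n m) (fun a => evalMat_TMN k a)
      (fun L _ _ φ hφ => agree_TMN k hn φ hφ) J h

end
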